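/- Let k ≥ 3, let q be a non-condensible permutation of length k with q_1 < q_k, and let α = 12⋯k. Then for every n ≥ k, V_n(q) ≤ V_n(α); that is, the number of permutations of length n that very tightly avoid q is at most the number of permutations of length n that very tightly avoid the monotone pattern α. -/

import Mathlib

/-- `p` has a *very tight* occurrence of the pattern `q` in the window of
positions `i, i+1, …, i+k-1` (0-indexed; this corresponds to the window
`p_{i+1} ⋯ p_{i+k}` in 1-indexed notation): the window is order-isomorphic
to `q` and its set of values is an interval of `k` consecutive values. -/
def IsVTO {n k : ℕ} (p : Equiv.Perm (Fin n)) (q : Equiv.Perm (Fin k)) (i : ℕ) : Prop :=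
  ∃ _hik : i + k ≤ n, ∃ a : ℕ, a + k ≤ n ∧
    (∀ j r : Fin k, q j < q r ↔
      p ⟨i + (j : ℕ), by have := j.isLt; omega⟩ <
        p ⟨i + (r : ℕ), by have := r.isLt; omega⟩) ∧
    Finset.image (fun j : Fin k => (p ⟨i + (j : ℕ), by have := j.isLt; omega⟩ : ℕ))
      Finset.univ = Finset.Ico a (a + k)

/-- The number of very tight occurrences of `q` in `p`. -/
noncomputable def numVTO {n k : ℕ} (p : Equiv.Perm (Fin n)) (q : Equiv.Perm (Fin k)) : ℕ :=
  Set.ncard {i : ℕ | IsVTO p q i}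

/-- The pattern `q` is condensible with parameter `s`: `1 ≤ s ≤ k-1`, the
rightmost `s` entries of `q` are its `s` largest entries, the leftmost `s`
entries are its `s` smallest entries, and the leftmost `s` entries are
order-isomorphic to the rightmost `s` entries. (0-indexed.) -/
def CondensibleAt {k : ℕ} (q : Equiv.Perm (Fin k)) (s : ℕ) : Prop :=
  ∃ _hs1 : 1 ≤ s, ∃ _hs2 : s ≤ k - 1,
    (∀ j : Fin k, k - s ≤ (j : ℕ) → k - s ≤ (q j : ℕ)) ∧
    (∀ j : Fin k, (j : ℕ) < s → (q j : ℕ) < s) ∧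
    ∀ j r : Fin k, ∀ _hj : (j : ℕ) < s, ∀ _hr : (r : ℕ) < s,
      (q j < q r ↔
        q ⟨(j : ℕ) + (k - s), by omega⟩ < q ⟨(r : ℕ) + (k - s), by omega⟩)

/-- The pattern `q` is condensible. -/
def Condensible {k : ℕ} (q : Equiv.Perm (Fin k)) : Prop :=
  ∃ s : ℕ, CondensibleAt q s

/-- `V n q`: the number of permutations of length `n` that very tightly avoid
the pattern `q`, i.e. have no very tight occurrence of `q`. -/
noncomputable def numVTAvoiders (n : ℕ) {k : ℕ} (q : Equiv.Perm (Fin k)) : ℕ :=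
  Nat.card {p : Equiv.Perm (Fin n) // ∀ i : ℕ, ¬ IsVTO p q i}

/-- `p` maps each position `i + j`, `j < k`, to the value `a + q j`. -/
def OccursAt {n k : ℕ} (p : Equiv.Perm (Fin n)) (q : Equiv.Perm (Fin k)) (i a : ℕ) : Prop :=
  ∀ (j : Fin k) (x : Fin n), (x : ℕ) = i + j → (p x : ℕ) = a + q j

theorem isVTO_iff_exists_occursAt {n k : ℕ} (p : Equiv.Perm (Fin n)) (q : Equiv.Perm (Fin k))
    (i : ℕ) : IsVTO p q i ↔ i + k ≤ n ∧ ∃ a, a + k ≤ n ∧ OccursAt p q i a := by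
  constructor
  · rintro ⟨hik, a, ha, hord, himg⟩
    refine ⟨hik, a, ha, ?_⟩
    have hmem : ∀ j : Fin k, a ≤ (p ⟨i + (j : ℕ), by omega⟩ : ℕ) ∧
        (p ⟨i + (j : ℕ), by omega⟩ : ℕ) < a + k := by
      intro j
      rw [← Finset.mem_Ico, ← himg]
      exact Finset.mem_image_of_mem _ (Finset.mem_univ j)
    let w : Fin k → Fin k := fun j =>
      ⟨(p ⟨i + (j : ℕ), by omega⟩ : ℕ) - a, by have := hmem j; omega⟩
    have hw : ∀ j r, q j < q r ↔ w j < w r := by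
      intro j r
      rw [hord, Fin.lt_def, Fin.lt_def]
      have := hmem j
      have := hmem r
      simp only [w]
      omega
    have hmono : StrictMono (w ∘ q.symm) := by
      intro x y hxy
      simpa [← hw] using hxy
    have hid : w ∘ q.symm = id := by
      refine (hmono.range_inj strictMono_id).1 ?_
      rw [Set.range_id]
      exact (Finite.injective_iff_surjective.1 hmono.injective).range_eq
    intro j x hx
    have h1 := congrArg Fin.val (congrFun hid (q j))
    simp only [Function.comp_apply, Equiv.symm_apply_apply, id_eq, w] at h1
    have hx' : x = ⟨i + (j : ℕ), by omega⟩ := Fin.ext hx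
    have := hmem j
    rw [hx']
    omega
  · rintro ⟨hik, a, ha, h⟩
    refine ⟨hik, a, ha, ?_, ?_⟩
    · intro j r
      rw [Fin.lt_def, Fin.lt_def, h j _ rfl, h r _ rfl]
      omega
    · ext v
      simp only [Finset.mem_image, Finset.mem_univ, true_and, Finset.mem_Ico]
      constructor
      · rintro ⟨j, rfl⟩
        rw [h j _ rfl]
        omega
      · rintro ⟨h1, h2⟩
        refine ⟨q.symm ⟨v - a, by omega⟩, ?_⟩
        rw [h _ _ rfl, Equiv.apply_symm_apply]
        simp only
        omega

/-- The number of permutations with prescribed values on a set of positions. -/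
theorem Equiv.Perm.card_filter_apply_eq {α ι : Type*} [Fintype α] [DecidableEq α] [Fintype ι]
    (f g : ι ↪ α) [DecidablePred fun p : Equiv.Perm α => ∀ j, p (f j) = g j] :
    (Finset.univ.filter fun p : Equiv.Perm α => ∀ j, p (f j) = g j).card =
      (Fintype.card α - Fintype.card ι).factorial := by
  classical
  let e : {x // x ∈ Set.range f} ≃ {x // x ∈ Set.range g} :=
    (Equiv.ofInjective f f.injective).symm.trans (Equiv.ofInjective g g.injective)
  let p₀ : Equiv.Perm α := e.extendSubtype
  have hp₀ : ∀ j, p₀ (f j) = g j := by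
    intro j
    have h1 := e.extendSubtype_apply_of_mem (f j) ⟨j, rfl⟩
    have h2 : (Equiv.ofInjective f f.injective).symm ⟨f j, ⟨j, rfl⟩⟩ = j :=
      Equiv.ofInjective_symm_apply f.injective j
    simp only [p₀, h1, e, Equiv.trans_apply, h2, Equiv.ofInjective_apply]
  have h1 : {p : Equiv.Perm α // ∀ j, p (f j) = g j} ≃
      {p : Equiv.Perm α // ∀ x, ¬ (x ∉ Set.range f) → p x = x} :=
    (Equiv.mulLeft p₀⁻¹).subtypeEquiv fun p => by
      simp [Equiv.symm_apply_eq, hp₀]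
  rw [← Fintype.card_subtype,
    Fintype.card_congr (h1.trans (Equiv.Perm.subtypeEquivSubtypePerm _).symm),
    Fintype.card_perm, Fintype.card_subtype_compl]
  congr 2
  exact (Fintype.card_congr (Equiv.ofInjective f f.injective)).symm

/-- The embedding of a window of length `k` starting at `i`. -/
def windowEmb {n k : ℕ} (i : ℕ) (h : i + k ≤ n) : Fin k ↪ Fin n where
  toFun j := ⟨i + j, by omega⟩
  inj' j r hjr := by
    have := congrArg Fin.val hjr
    simp only at this
    exact Fin.ext (by omega)

theorem occursAt_iff_windowEmb {n k : ℕ} (p : Equiv.Perm (Fin n)) (q : Equiv.Perm (Fin k))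
    {i a : ℕ} (hi : i + k ≤ n) (ha : a + k ≤ n) :
    OccursAt p q i a ↔ ∀ j, p (windowEmb i hi j) = (q.toEmbedding.trans (windowEmb a ha)) j := by
  constructor
  · intro h j
    exact Fin.ext (h j _ rfl)
  · intro h j x hx
    have hx' : x = windowEmb i hi j := Fin.ext hx
    rw [hx', h j]
    rfl

open Classical in
theorem card_filter_occursAt {n k : ℕ} (q : Equiv.Perm (Fin k)) {i a : ℕ} (hi : i + k ≤ n)
    (ha : a + k ≤ n) :
    (Finset.univ.filter fun p : Equiv.Perm (Fin n) => OccursAt p q i a).card =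
      (n - k).factorial := by
  simp only [occursAt_iff_windowEmb _ q hi ha]
  rw [Equiv.Perm.card_filter_apply_eq, Fintype.card_fin, Fintype.card_fin]

/-- The embedding of two disjoint windows. -/
def windowPairEmb {n k : ℕ} (i i' : ℕ) (h : i + k ≤ n) (h' : i' + k ≤ n)
    (hd : i + k ≤ i' ∨ i' + k ≤ i) : Fin k ⊕ Fin k ↪ Fin n where
  toFun := Sum.elim (windowEmb i h) (windowEmb i' h')
  inj' := by
    refine Function.Injective.sumElim (windowEmb i h).injective (windowEmb i' h').injective ?_
    intro j r hjr
    have : i + (j : ℕ) = i' + r := congrArg Fin.val hjr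
    omega

open Classical in
theorem card_filter_occursAt_pair {n k : ℕ} (q : Equiv.Perm (Fin k)) {i a i' a' : ℕ}
    (hi : i + k ≤ n) (ha : a + k ≤ n) (hi' : i' + k ≤ n) (ha' : a' + k ≤ n)
    (hdi : i + k ≤ i' ∨ i' + k ≤ i) (hda : a + k ≤ a' ∨ a' + k ≤ a) :
    (Finset.univ.filter fun p : Equiv.Perm (Fin n) =>
      OccursAt p q i a ∧ OccursAt p q i' a').card = (n - 2 * k).factorial := by
  have key : ∀ p : Equiv.Perm (Fin n), (OccursAt p q i a ∧ OccursAt p q i' a') ↔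
      ∀ j, p (windowPairEmb i i' hi hi' hdi j) =
        ((q.sumCongr q).toEmbedding.trans (windowPairEmb a a' ha ha' hda)) j := by
    intro p
    rw [occursAt_iff_windowEmb _ q hi ha, occursAt_iff_windowEmb _ q hi' ha', Sum.forall]
    rfl
  simp only [key]
  rw [Equiv.Perm.card_filter_apply_eq, Fintype.card_fin, Fintype.card_sum, Fintype.card_fin,
    two_mul]

theorem OccursAt.mem_window {n k : ℕ} {p : Equiv.Perm (Fin n)} {q : Equiv.Perm (Fin k)}
    {i a : ℕ} (h : OccursAt p q i a) (hi : i + k ≤ n) {x : Fin n} (h1 : a ≤ p x)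
    (h2 : (p x : ℕ) < a + k) : i ≤ x ∧ (x : ℕ) < i + k := by
  let j : Fin k := q.symm ⟨p x - a, by omega⟩
  have hj := h j ⟨i + j, by omega⟩ rfl
  have hx : (⟨i + j, by omega⟩ : Fin n) = x := by
    apply p.injective
    apply Fin.ext
    rw [hj]
    simp only [j, Equiv.apply_symm_apply]
    omega
  have := congrArg Fin.val hx
  simp only at this
  omega

theorem OccursAt.value_unique {n k : ℕ} {p : Equiv.Perm (Fin n)} {q : Equiv.Perm (Fin k)}
    {i a a' : ℕ} (hk : 0 < k) (hi : i + k ≤ n) (h : OccursAt p q i a)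
    (h' : OccursAt p q i a') : a = a' := by
  have h1 := h ⟨0, hk⟩ ⟨i, by omega⟩ rfl
  have h2 := h' ⟨0, hk⟩ ⟨i, by omega⟩ rfl
  omega

/-- If `q` descends by `d` under a shift by `d`, its first entry exceeds its last entry. -/
theorem last_lt_first_of_shift {k d : ℕ} (q : Equiv.Perm (Fin k)) (hd : 0 < d) (hdk : d < k)
    (h : ∀ j r : Fin k, (r : ℕ) = j + d → (q r : ℕ) + d = q j) :
    q ⟨k - 1, by omega⟩ < q ⟨0, by omega⟩ := by
  have iter : ∀ (m : ℕ) (j r : Fin k), (r : ℕ) = j + m * d → (q r : ℕ) + m * d = q j := by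
    intro m
    induction m with
    | zero =>
      intro j r hr
      have : r = j := Fin.ext (by omega)
      simp [this]
    | succ m ih =>
      intro j r hr
      rw [Nat.succ_mul] at hr ⊢
      have h1 := ih j ⟨j + m * d, by omega⟩ rfl
      have h2 := h ⟨j + m * d, by omega⟩ r (by simp only; omega)
      omega
  let m := (k - 1) / d
  have hm1 : m * d ≤ k - 1 := Nat.div_mul_le_self _ _
  have hm2 : k - 1 < m * d + d := Nat.lt_div_mul_add hd
  have hm3 : d ≤ m * d := Nat.le_mul_of_pos_left _ (Nat.div_pos (by omega) hd)
  have h1 := iter m ⟨0, by omega⟩ ⟨m * d, by omega⟩ (by simp)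
  have h2 := iter m ⟨k - 1 - m * d, by omega⟩ ⟨k - 1, by omega⟩ (by simp only; omega)
  rw [Fin.lt_def]
  omega

theorem Fin.card_filter_le_val {k d : ℕ} :
    (Finset.univ.filter fun j : Fin k => d ≤ (j : ℕ)).card = k - d := by
  have h := Finset.card_image_of_injective
    (Finset.univ.filter fun j : Fin k => d ≤ (j : ℕ)) Fin.val_injective
  rw [← h, ← Nat.card_Ico]
  congr 1
  ext x
  simp only [Finset.mem_image, Finset.mem_filter, Finset.mem_univ, true_and, Finset.mem_Ico]
  exact ⟨by rintro ⟨j, hj, rfl⟩; omega, fun hx => ⟨⟨x, hx.2⟩, hx.1, rfl⟩⟩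

theorem Fin.card_filter_val_lt_sub {k e : ℕ} :
    (Finset.univ.filter fun j : Fin k => (j : ℕ) < k - e).card = k - e := by
  have h := Finset.card_image_of_injective
    (Finset.univ.filter fun j : Fin k => (j : ℕ) < k - e) Fin.val_injective
  rw [← h]
  conv_rhs => rw [← Finset.card_range (k - e)]
  congr 1
  ext x
  simp only [Finset.mem_image, Finset.mem_filter, Finset.mem_univ, true_and, Finset.mem_range]
  exact ⟨by rintro ⟨j, hj, rfl⟩; omega, fun hx => ⟨⟨x, by omega⟩, hx, rfl⟩⟩

theorem Equiv.Perm.card_filter_comp {α : Type*} [Fintype α] (q : Equiv.Perm α)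
    (P : α → Prop) [DecidablePred P] :
    (Finset.univ.filter fun j => P (q j)).card = (Finset.univ.filter P).card := by
  rw [← Fintype.card_subtype, ← Fintype.card_subtype]
  exact Fintype.card_congr (q.subtypeEquiv fun _ => Iff.rfl)

/-- Occurrences of a non-condensible pattern with `q_1 < q_k` do not overlap. -/
theorem OccursAt.not_overlap {n k : ℕ} {p : Equiv.Perm (Fin n)} {q : Equiv.Perm (Fin k)}
    {i a i' a' : ℕ} (hk : 0 < k) (hq : q ⟨0, by omega⟩ < q ⟨k - 1, by omega⟩)
    (hnc : ¬ Condensible q) (hi' : i' + k ≤ n)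
    (h : OccursAt p q i a) (h' : OccursAt p q i' a') (hlt : i < i') : i + k ≤ i' := by
  by_contra hcon
  obtain ⟨d, rfl⟩ : ∃ d, i' = i + d := ⟨i' - i, by omega⟩
  have hshift : ∀ j r : Fin k, (r : ℕ) = j + d → a + (q r : ℕ) = a' + q j := by
    intro j r hr
    rw [← h r ⟨i + r, by omega⟩ rfl, ← h' j ⟨i + r, by omega⟩ (by simp only; omega)]
  have hback : ∀ j : Fin k, a' ≤ a + q j → a + (q j : ℕ) < a' + k → d ≤ (j : ℕ) := by
    intro j h1 h2
    have hj := h j ⟨i + j, by omega⟩ rfl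
    have := h'.mem_window hi' (x := ⟨i + j, by omega⟩) (by omega) (by omega)
    simp only at this
    omega
  rcases le_total a a' with haa | haa
  · obtain ⟨e, rfl⟩ : ∃ e, a' = a + e := ⟨a' - a, by omega⟩
    have hiff : ∀ j : Fin k, d ≤ (j : ℕ) ↔ e ≤ (q j : ℕ) := by
      intro j
      constructor
      · intro hj
        have := hshift ⟨j - d, by omega⟩ j (by simp only; omega)
        omega
      · intro hj
        exact hback j (by omega) (by omega)
    have hcard : k - d = k - e := by
      rw [← Fin.card_filter_le_val (k := k) (d := d), ← Fin.card_filter_le_val (k := k) (d := e),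
        ← q.card_filter_comp fun j => e ≤ (j : ℕ)]
      simp only [hiff]
    obtain rfl : d = e := by omega
    refine hnc ⟨k - d, by omega, by omega, ?_, ?_, ?_⟩
    · intro j hj
      have := (hiff j).1 (by omega)
      omega
    · intro j hj
      have := hshift j ⟨j + d, by omega⟩ rfl
      omega
    · intro j r hj hr
      have h1 := hshift j ⟨j + (k - (k - d)), by omega⟩ (by simp only; omega)
      have h2 := hshift r ⟨r + (k - (k - d)), by omega⟩ (by simp only; omega)
      rw [Fin.lt_def, Fin.lt_def]
      omega
  · obtain ⟨e, rfl⟩ : ∃ e, a = a' + e := ⟨a - a', by omega⟩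
    have hiff : ∀ j : Fin k, d ≤ (j : ℕ) ↔ (q j : ℕ) < k - e := by
      intro j
      constructor
      · intro hj
        have := hshift ⟨j - d, by omega⟩ j (by simp only; omega)
        omega
      · intro hj
        exact hback j (by omega) (by omega)
    have hcard : k - d = k - e := by
      rw [← Fin.card_filter_le_val (k := k) (d := d),
        ← Fin.card_filter_val_lt_sub (k := k) (e := e),
        ← q.card_filter_comp fun j => (j : ℕ) < k - e]
      simp only [hiff]
    obtain rfl : d = e := by omega
    refine lt_asymm hq (last_lt_first_of_shift (d := d) q (by omega) (by omega) ?_)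
    intro j r hr
    have := hshift j r hr
    omega

/-- Value windows of occurrences with disjoint position windows are disjoint. -/
theorem OccursAt.value_disjoint {n k : ℕ} {p : Equiv.Perm (Fin n)} {q : Equiv.Perm (Fin k)}
    {i a i' a' : ℕ} (hi' : i' + k ≤ n) (h : OccursAt p q i a) (h' : OccursAt p q i' a')
    (hlt : i + k ≤ i') : a + k ≤ a' ∨ a' + k ≤ a := by
  by_contra hcon
  obtain ⟨v, h1, h2, h3, h4⟩ : ∃ v, a ≤ v ∧ v < a + k ∧ a' ≤ v ∧ v < a' + k := by
    rcases le_total a a' with haa | haa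
    · exact ⟨a', by omega⟩
    · exact ⟨a, by omega⟩
  let j : Fin k := q.symm ⟨v - a, by omega⟩
  have hj := h j ⟨i + j, by omega⟩ rfl
  have hqj : (q j : ℕ) = v - a := by simp [j]
  have := h'.mem_window hi' (x := ⟨i + j, by omega⟩) (by omega) (by omega)
  simp only at this
  omega

/-- The pairs (position, value) at which a window of length `k` may start. -/
def windowStarts (n k : ℕ) : Finset (ℕ × ℕ) :=
  Finset.range (n + 1 - k) ×ˢ Finset.range (n + 1 - k)

theorem mem_windowStarts {n k : ℕ} {x : ℕ × ℕ} :
    x ∈ windowStarts n k ↔ x.1 + k ≤ n ∧ x.2 + k ≤ n := by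
  simp only [windowStarts, Finset.mem_product, Finset.mem_range]
  omega

/-- The pairs of windows with disjoint positions (in increasing order) and disjoint values. -/
def windowPairs (n k : ℕ) : Finset ((ℕ × ℕ) × (ℕ × ℕ)) :=
  (windowStarts n k ×ˢ windowStarts n k).filter fun x =>
    x.1.1 + k ≤ x.2.1 ∧ (x.1.2 + k ≤ x.2.2 ∨ x.2.2 + k ≤ x.1.2)

theorem mem_windowPairs {n k : ℕ} {x : (ℕ × ℕ) × (ℕ × ℕ)} :
    x ∈ windowPairs n k ↔ ((x.1.1 + k ≤ n ∧ x.1.2 + k ≤ n) ∧ x.2.1 + k ≤ n ∧ x.2.2 + k ≤ n) ∧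
      x.1.1 + k ≤ x.2.1 ∧ (x.1.2 + k ≤ x.2.2 ∨ x.2.2 + k ≤ x.1.2) := by
  simp only [windowPairs, Finset.mem_filter, Finset.mem_product, mem_windowStarts]

theorem card_windowPairs_le {n k : ℕ} (hk : 0 < k) :
    (windowPairs n k).card ≤ (n - 2 * k + 2) ^ 4 := by
  let R := Finset.range (n - 2 * k + 2)
  have hR : ((R ×ˢ R) ×ˢ (R ×ˢ R)).card = (n - 2 * k + 2) ^ 4 := by
    simp only [Finset.card_product, R, Finset.card_range]
    ring
  rw [← hR]
  refine Finset.card_le_card_of_injOn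
    (fun x => if x.1.2 < x.2.2 then ((x.1.1, x.2.1 - k), (x.1.2, x.2.2 - k))
      else ((x.2.1 - k + 1, x.1.1), (x.1.2 - k, x.2.2))) ?_ ?_
  · rintro ⟨⟨i, a⟩, ⟨i', a'⟩⟩ hx
    rw [Finset.mem_coe, mem_windowPairs] at hx
    simp only at hx
    rw [Finset.mem_coe]
    simp only
    split_ifs <;> simp only [Finset.mem_product, R, Finset.mem_range] <;> omega
  · rintro ⟨⟨i, a⟩, ⟨i', a'⟩⟩ hx ⟨⟨j, b⟩, ⟨j', b'⟩⟩ hy hxy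
    rw [Finset.mem_coe, mem_windowPairs] at hx hy
    simp only at hx hy hxy
    split_ifs at hxy <;> simp only [Prod.mk.injEq] at hxy ⊢ <;> omega

theorem card_windowPairs_mul_factorial_le {n k : ℕ} (hk : 3 ≤ k) :
    (windowPairs n k).card * (n - 2 * k).factorial ≤ (n - k) * (n - k).factorial := by
  by_cases hn : 2 * k ≤ n
  · obtain ⟨E, rfl⟩ : ∃ E, n = 2 * k + E := ⟨n - 2 * k, by omega⟩
    have hcard := card_windowPairs_le (n := 2 * k + E) (k := k) (by omega)
    rw [Nat.add_sub_cancel_left] at hcard ⊢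
    have h1 : E + 3 ≤ 2 * k + E - k := by omega
    calc _ ≤ (E + 2) ^ 4 * E.factorial := Nat.mul_le_mul_right _ hcard
      _ ≤ (E + 3) * (E + 3).factorial := by
        simp only [Nat.factorial_succ]
        have : (E + 2) ^ 4 ≤ (E + 3) * ((E + 3) * ((E + 2) * (E + 1))) :=
          Nat.le.intro (k := (E + 2) * (E ^ 2 + 3 * E + 1)) (by ring)
        calc _ ≤ (E + 3) * ((E + 3) * ((E + 2) * (E + 1))) * E.factorial :=
              Nat.mul_le_mul_right _ this
          _ = _ := by ring
      _ ≤ _ := Nat.mul_le_mul h1 (Nat.factorial_le h1)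
  · have : windowPairs n k = ∅ := by
      rw [Finset.eq_empty_iff_forall_notMem]
      intro x hx
      rw [mem_windowPairs] at hx
      omega
    simp [this]

open Classical in
theorem sum_card_filter_occursAt {n k : ℕ} (q : Equiv.Perm (Fin k)) :
    ∑ p : Equiv.Perm (Fin n), ((windowStarts n k).filter fun x => OccursAt p q x.1 x.2).card =
      (n + 1 - k) ^ 2 * (n - k).factorial := by
  have h := Finset.sum_card_bipartiteAbove_eq_sum_card_bipartiteBelow
    (s := (Finset.univ : Finset (Equiv.Perm (Fin n)))) (t := windowStarts n k)
    (fun p x => OccursAt p q x.1 x.2)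
  simp only [Finset.bipartiteAbove, Finset.bipartiteBelow] at h
  rw [h, Finset.sum_const_nat (m := (n - k).factorial)]
  · simp [windowStarts, sq]
  · intro x hx
    rw [mem_windowStarts] at hx
    exact card_filter_occursAt q hx.1 hx.2

open Classical in
theorem sum_card_filter_occursAt_pair {n k : ℕ} (q : Equiv.Perm (Fin k)) :
    ∑ p : Equiv.Perm (Fin n), ((windowPairs n k).filter fun x =>
        OccursAt p q x.1.1 x.1.2 ∧ OccursAt p q x.2.1 x.2.2).card =
      (windowPairs n k).card * (n - 2 * k).factorial := by
  have h := Finset.sum_card_bipartiteAbove_eq_sum_card_bipartiteBelow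
    (s := (Finset.univ : Finset (Equiv.Perm (Fin n)))) (t := windowPairs n k)
    (fun p x => OccursAt p q x.1.1 x.1.2 ∧ OccursAt p q x.2.1 x.2.2)
  simp only [Finset.bipartiteAbove, Finset.bipartiteBelow] at h
  rw [h, Finset.sum_const_nat (m := (n - 2 * k).factorial)]
  intro x hx
  rw [mem_windowPairs] at hx
  exact card_filter_occursAt_pair q hx.1.1.1 hx.1.1.2 hx.1.2.1 hx.1.2.2 (Or.inl hx.2.1) hx.2.2

open Classical in
theorem exists_isVTO_iff_nonempty {n k : ℕ} (p : Equiv.Perm (Fin n)) (q : Equiv.Perm (Fin k)) :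
    (∃ i, IsVTO p q i) ↔
      ((windowStarts n k).filter fun x => OccursAt p q x.1 x.2).Nonempty := by
  simp only [isVTO_iff_exists_occursAt, Finset.Nonempty, Finset.mem_filter, mem_windowStarts,
    Prod.exists]
  exact exists_congr fun i => ⟨fun ⟨h, a, h1, h2⟩ => ⟨a, ⟨h, h1⟩, h2⟩,
    fun ⟨a, ⟨h, h1⟩, h2⟩ => ⟨h, a, h1, h2⟩⟩

open Classical in
/-- The number of occurrences in `p` exceeds the number of pairs of occurrences by at most one,
and only if `p` contains the pattern. -/
theorem card_occurrences_le {n k : ℕ} {q : Equiv.Perm (Fin k)} (hk : 0 < k)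
    (hq : q ⟨0, by omega⟩ < q ⟨k - 1, by omega⟩) (hnc : ¬ Condensible q)
    (p : Equiv.Perm (Fin n)) :
    ((windowStarts n k).filter fun x => OccursAt p q x.1 x.2).card ≤
      (if ∃ i, IsVTO p q i then 1 else 0) + ((windowPairs n k).filter fun x =>
        OccursAt p q x.1.1 x.1.2 ∧ OccursAt p q x.2.1 x.2.2).card := by
  set S := (windowStarts n k).filter fun x => OccursAt p q x.1 x.2 with hS
  rw [exists_isVTO_iff_nonempty, ← hS]
  split_ifs with hne
  · obtain ⟨x₀, hx₀, hmin⟩ := S.exists_min_image Prod.fst hne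
    rw [← Finset.card_erase_add_one hx₀, add_comm]
    refine Nat.add_le_add_left (Finset.card_le_card_of_injOn (fun y => (x₀, y)) ?_ ?_) 1
    · intro y hy
      rw [Finset.mem_coe, Finset.mem_erase] at hy
      obtain ⟨hy0, hy⟩ := hy
      have hle := hmin y hy
      simp only [hS, Finset.mem_filter, mem_windowStarts] at hx₀ hy
      have hlt : x₀.1 < y.1 := by
        refine lt_of_le_of_ne hle fun heq => hy0 (Prod.ext heq.symm ?_)
        exact OccursAt.value_unique hk hy.1.1 hy.2 (heq ▸ hx₀.2)
      have hd := hx₀.2.not_overlap hk hq hnc hy.1.1 hy.2 hlt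
      rw [Finset.mem_coe, Finset.mem_filter, mem_windowPairs]
      exact ⟨⟨⟨hx₀.1, hy.1⟩, hd, hx₀.2.value_disjoint hy.1.1 hy.2 hd⟩, hx₀.2, hy.2⟩
    · intro y _ z _ hyz
      exact (Prod.mk.inj hyz).2
  · rw [Finset.not_nonempty_iff_eq_empty.1 hne]
    simp

open Classical in
/-- A permutation containing `12⋯k` has more occurrences of `12⋯k` than of `12⋯(k+1)`. -/
theorem card_occurrences_refl_ge {n k : ℕ} (p : Equiv.Perm (Fin n)) :
    (if ∃ i, IsVTO p (Equiv.refl (Fin k)) i then 1 else 0) +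
      ((windowStarts n (k + 1)).filter fun x =>
        OccursAt p (Equiv.refl (Fin (k + 1))) x.1 x.2).card ≤
      ((windowStarts n k).filter fun x => OccursAt p (Equiv.refl (Fin k)) x.1 x.2).card := by
  set S := (windowStarts n k).filter fun x => OccursAt p (Equiv.refl (Fin k)) x.1 x.2 with hS
  set T := (windowStarts n (k + 1)).filter fun x =>
    OccursAt p (Equiv.refl (Fin (k + 1))) x.1 x.2 with hT
  have hT0 : ∀ x ∈ T, x ∈ S := by
    intro x hx
    simp only [hS, hT, Finset.mem_filter, mem_windowStarts] at hx ⊢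
    refine ⟨by omega, fun j y hy => ?_⟩
    exact hx.2 j.castSucc y hy
  have hT1 : ∀ x ∈ T, (x.1 + 1, x.2 + 1) ∈ S := by
    intro x hx
    simp only [hS, hT, Finset.mem_filter, mem_windowStarts] at hx ⊢
    refine ⟨by omega, fun j y hy => ?_⟩
    have := hx.2 j.succ y (by simp only [Fin.val_succ]; omega)
    simp only [Equiv.refl_apply, Fin.val_succ] at this ⊢
    omega
  have hinj : Set.InjOn (fun x : ℕ × ℕ => (x.1 + 1, x.2 + 1)) T := by
    rintro ⟨i, a⟩ _ ⟨j, b⟩ _ h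
    simpa using h
  rw [exists_isVTO_iff_nonempty, ← hS]
  split_ifs with hne
  · obtain ⟨x₀, hx₀, hmin⟩ := S.exists_min_image Prod.fst hne
    rw [← Finset.card_erase_add_one hx₀, add_comm]
    refine Nat.add_le_add_right (Finset.card_le_card_of_injOn _ ?_ hinj) 1
    intro x hx
    rw [Finset.mem_coe, Finset.mem_erase]
    refine ⟨fun h => ?_, hT1 x hx⟩
    have := hmin x (hT0 x hx)
    rw [← h] at this
    simp only at this
    omega
  · rw [zero_add]
    exact Finset.card_le_card_of_injOn _ hT1 hinj

open Classical in
theorem numVTAvoiders_add_card {n k : ℕ} (q : Equiv.Perm (Fin k)) :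
    numVTAvoiders n q + ∑ p : Equiv.Perm (Fin n), (if ∃ i, IsVTO p q i then 1 else 0) =
      n.factorial := by
  rw [numVTAvoiders, Nat.card_eq_fintype_card, Fintype.card_subtype, ← Finset.card_filter,
    add_comm]
  simp only [← not_exists]
  rw [Finset.card_filter_add_card_filter_not, Finset.card_univ, Fintype.card_perm,
    Fintype.card_fin]

/-- Let `k ≥ 3`, let `q` be a non-condensible pattern of length `k` with first
entry smaller than last entry, and let `α = 12⋯k` be the identity pattern.
Then for every `n ≥ k`, `V_n(q) ≤ V_n(α)`. -/
theorem stmt_12 {k : ℕ} (hk : 3 ≤ k) (q : Equiv.Perm (Fin k))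
    (hq : q ⟨0, by omega⟩ < q ⟨k - 1, by omega⟩) (hnc : ¬ Condensible q)
    (n : ℕ) (hn : k ≤ n) :
    numVTAvoiders n q ≤ numVTAvoiders n (Equiv.refl (Fin k)) := by
  classical
  have hq' := Finset.sum_le_sum fun p (_ : p ∈ (Finset.univ : Finset (Equiv.Perm (Fin n)))) =>
    card_occurrences_le (by omega) hq hnc p
  have hα := Finset.sum_le_sum fun p (_ : p ∈ (Finset.univ : Finset (Equiv.Perm (Fin n)))) =>
    card_occurrences_refl_ge (k := k) p
  simp only [Finset.sum_add_distrib, sum_card_filter_occursAt,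
    sum_card_filter_occursAt_pair] at hq' hα
  have hpairs := card_windowPairs_mul_factorial_le (n := n) hk
  have hsq : (n + 1 - (k + 1)) ^ 2 * (n - (k + 1)).factorial = (n - k) * (n - k).factorial := by
    obtain ⟨D, rfl⟩ : ∃ D, n = k + D := ⟨n - k, by omega⟩
    have h1 : k + D + 1 - (k + 1) = D := by omega
    have h2 : k + D - (k + 1) = D - 1 := by omega
    rw [h1, h2, Nat.add_sub_cancel_left]
    rcases D with _ | D
    · simp
    · rw [Nat.add_sub_cancel, Nat.factorial_succ]
      ring
  have h1 := numVTAvoiders_add_card (n := n) q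
  have h2 := numVTAvoiders_add_card (n := n) (Equiv.refl (Fin k))
  omega
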